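/- Let γ > 0, let X be an ℝ^d-valued random vector with density p_γ (isotropic Cauchy of scale γ), and let C be a standard d-dimensional isotropic Cauchy vector independent of X. Then for every t > 0 the sum X + tC has density p_{γ+t}, so that h(X + tC) = h(X) + d·ln((γ+t)/γ), and consequently J₁(X) = lim_{t→0⁺} (h(X+tC) − h(X))/t = d/γ. (This is Property (4) of the paper's α-Fisher information specialized to α = 1: the α-Fisher information of a symmetric stable vector S(α, γ) equals (d/α)·γ^{-α}.) -/

import Mathlib

open MeasureTheory ProbabilityTheory Real Filter Topology

/-- The standard `d`-dimensional isotropic Cauchy density. -/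
noncomputable def pC (d : ℕ) (x : EuclideanSpace ℝ (Fin d)) : ℝ :=
  Real.Gamma (((d : ℝ) + 1) / 2) * Real.pi ^ (-((d : ℝ) + 1) / 2) *
    (1 + ‖x‖ ^ 2) ^ (-((d : ℝ) + 1) / 2)

/-- The isotropic Cauchy density with scale `γ`. -/
noncomputable def pGam (d : ℕ) (γ : ℝ) (x : EuclideanSpace ℝ (Fin d)) : ℝ :=
  γ ^ (-(d : ℝ)) * pC d (γ⁻¹ • x)

/-- Differential entropy of a density on `ℝ^d` (natural logarithm). -/
noncomputable def dEnt {d : ℕ} (f : EuclideanSpace ℝ (Fin d) → ℝ) : ℝ :=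
  -∫ x, f x * Real.log (f x)

/-- The Glasser change of variables `w = v - a / v` for the Gaussian integral. -/
lemma integral_exp_neg_sub_div_sq_mul {a : ℝ} (ha : 0 < a) :
    IntegrableOn (fun v : ℝ => (1 + a / v ^ 2) * exp (-(v - a / v) ^ 2)) (Set.Ioi 0) ∧
    ∫ v in Set.Ioi (0 : ℝ), (1 + a / v ^ 2) * exp (-(v - a / v) ^ 2) = √π := by
  have hderiv : ∀ v ∈ Set.Ioi (0 : ℝ),
      HasDerivWithinAt (fun v => v - a / v) (1 + a / v ^ 2) (Set.Ioi 0) v := by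
    intro v hv
    have hv0 : v ≠ 0 := ne_of_gt hv
    have h := (hasDerivAt_id v).sub ((hasDerivAt_inv hv0).const_mul a)
    refine (h.congr_deriv ?_).hasDerivWithinAt
    field_simp
    ring
  have hmono : MonotoneOn (fun v : ℝ => v - a / v) (Set.Ioi 0) := by
    intro x hx y _ hxy
    have : a / y ≤ a / x := div_le_div_of_nonneg_left ha.le hx hxy
    simp only
    linarith
  have himage : (fun v : ℝ => v - a / v) '' Set.Ioi 0 = Set.univ := by
    refine Set.eq_univ_of_forall fun w => ?_
    have hsq : √(w ^ 2 + 4 * a) ^ 2 = w ^ 2 + 4 * a := Real.sq_sqrt (by positivity)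
    have hlt : |w| < √(w ^ 2 + 4 * a) := by
      rw [← Real.sqrt_sq_eq_abs]
      exact Real.sqrt_lt_sqrt (sq_nonneg w) (by linarith)
    have hpos : 0 < w + √(w ^ 2 + 4 * a) := by linarith [neg_abs_le w]
    refine ⟨(w + √(w ^ 2 + 4 * a)) / 2, half_pos hpos, ?_⟩
    simp only
    field_simp
    nlinarith
  have hgauss := integrable_exp_neg_mul_sq (one_pos : (0 : ℝ) < 1)
  have hint := (integrableOn_image_iff_integrableOn_deriv_smul_of_monotoneOn measurableSet_Ioi
    hderiv hmono (fun w => exp (-1 * w ^ 2))).1 hgauss.integrableOn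
  have heq := integral_image_eq_integral_deriv_smul_of_monotoneOn measurableSet_Ioi
    hderiv hmono (fun w => exp (-1 * w ^ 2))
  rw [himage, setIntegral_univ, integral_gaussian, div_one] at heq
  simp only [smul_eq_mul, neg_one_mul] at hint heq
  exact ⟨hint, heq.symm⟩

lemma integral_exp_neg_sub_div_sq {a : ℝ} (ha : 0 < a) :
    ∫ v in Set.Ioi (0 : ℝ), exp (-(v - a / v) ^ 2) = √π / 2 := by
  obtain ⟨hint, heq⟩ := integral_exp_neg_sub_div_sq_mul ha
  have hI : IntegrableOn (fun v : ℝ => exp (-(v - a / v) ^ 2)) (Set.Ioi 0) := by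
    refine hint.mono' (by fun_prop) ?_
    filter_upwards with v
    rw [Real.norm_of_nonneg (exp_pos _).le]
    have : 0 ≤ a / v ^ 2 := by positivity
    nlinarith [exp_pos (-(v - a / v) ^ 2)]
  have hderiv : ∀ v ∈ Set.Ioi (0 : ℝ),
      HasDerivWithinAt (fun v => a / v) (-(a / v ^ 2)) (Set.Ioi 0) v := by
    intro v hv
    have hv0 : v ≠ 0 := ne_of_gt hv
    refine (((hasDerivAt_inv hv0).const_mul a).congr_deriv ?_).hasDerivWithinAt
    field_simp
  have hanti : AntitoneOn (fun v : ℝ => a / v) (Set.Ioi 0) := fun x hx y _ hxy =>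
    div_le_div_of_nonneg_left ha.le hx hxy
  have himage : (fun v : ℝ => a / v) '' Set.Ioi 0 = Set.Ioi 0 := by
    ext w
    constructor
    · rintro ⟨v, hv, rfl⟩
      exact div_pos ha hv
    · intro hw
      refine ⟨a / w, div_pos ha hw, ?_⟩
      have : w ≠ 0 := ne_of_gt hw
      simp only
      field_simp
  have hswap := integral_image_eq_integral_deriv_smul_of_antitoneOn measurableSet_Ioi
    hderiv hanti (fun v => exp (-(v - a / v) ^ 2))
  rw [himage] at hswap
  have hsplit : ∫ v in Set.Ioi (0 : ℝ), (1 + a / v ^ 2) * exp (-(v - a / v) ^ 2) =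
      (∫ v in Set.Ioi (0 : ℝ), exp (-(v - a / v) ^ 2)) +
        ∫ v in Set.Ioi (0 : ℝ), a / v ^ 2 * exp (-(v - a / v) ^ 2) := by
    rw [← integral_add hI]
    · exact integral_congr_ae (.of_forall fun v => by ring)
    · refine (hint.sub hI).congr (.of_forall fun v => ?_)
      simp only [Pi.sub_apply]
      ring
  have hsecond : ∫ v in Set.Ioi (0 : ℝ), a / v ^ 2 * exp (-(v - a / v) ^ 2) =
      ∫ v in Set.Ioi (0 : ℝ), exp (-(v - a / v) ^ 2) := by
    rw [hswap]
    refine setIntegral_congr_fun measurableSet_Ioi fun v hv => ?_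
    have hv0 : v ≠ 0 := ne_of_gt hv
    simp only [smul_eq_mul, neg_neg]
    rw [div_div_cancel₀ ha.ne', ← neg_sub v (a / v), neg_sq]
  linarith

/-- The Bochner subordination identity. -/
lemma integral_rpow_mul_exp_neg_sub_div {r : ℝ} (hr : 0 ≤ r) :
    ∫ u in Set.Ioi (0 : ℝ), u ^ (-(1 / 2) : ℝ) * exp (-u - r ^ 2 / (4 * u)) =
      √π * exp (-r) := by
  rcases hr.eq_or_lt with rfl | hr
  · have h := Real.integral_rpow_mul_exp_neg_mul_Ioi (a := 1 / 2) (r := 1) (by norm_num) one_pos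
    rw [Real.Gamma_one_half_eq] at h
    norm_num at h ⊢
    exact h
  rw [← integral_comp_rpow_Ioi_of_pos (p := 2) two_pos]
  have hcongr : ∀ v ∈ Set.Ioi (0 : ℝ),
      ((2 : ℝ) * v ^ ((2 : ℝ) - 1)) • ((v ^ (2 : ℝ)) ^ (-(1 / 2) : ℝ) *
        exp (-v ^ (2 : ℝ) - r ^ 2 / (4 * v ^ (2 : ℝ)))) =
      (2 * exp (-r)) * exp (-(v - r / 2 / v) ^ 2) := by
    intro v hv
    have hv0 : (0 : ℝ) < v := hv
    have hexp : exp (-v ^ (2 : ℝ) - r ^ 2 / (4 * v ^ (2 : ℝ))) =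
        exp (-r) * exp (-(v - r / 2 / v) ^ 2) := by
      rw [← exp_add, Real.rpow_two]
      congr 1
      field_simp
      ring
    have hpow : v ^ ((2 : ℝ) - 1) * (v ^ (2 : ℝ)) ^ (-(1 / 2) : ℝ) = 1 := by
      rw [← Real.rpow_mul hv0.le, ← Real.rpow_add hv0]
      norm_num
    rw [hexp, smul_eq_mul]
    linear_combination (2 * exp (-r) * exp (-(v - r / 2 / v) ^ 2)) * hpow
  rw [setIntegral_congr_fun measurableSet_Ioi hcongr, integral_const_mul,
    integral_exp_neg_sub_div_sq (half_pos hr)]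
  ring

section Cauchy

variable {d : ℕ}

lemma measurable_pC : Measurable (pC d) := by
  unfold pC
  fun_prop

lemma pC_pos (x : EuclideanSpace ℝ (Fin d)) : 0 < pC d x := by
  have : 0 < Real.Gamma (((d : ℝ) + 1) / 2) := Real.Gamma_pos_of_pos (by positivity)
  unfold pC
  positivity

lemma measurable_pGam (γ : ℝ) : Measurable (pGam d γ) :=
  (measurable_pC.comp (measurable_const_smul γ⁻¹)).const_mul _

lemma pGam_pos {γ : ℝ} (hγ : 0 < γ) (x : EuclideanSpace ℝ (Fin d)) : 0 < pGam d γ x :=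
  mul_pos (Real.rpow_pos_of_pos hγ _) (pC_pos _)

lemma integrable_pC : Integrable (pC d) := by
  have h := integrable_rpow_neg_one_add_norm_sq (E := EuclideanSpace ℝ (Fin d)) (μ := volume)
    (r := (d : ℝ) + 1) (by simp)
  exact h.const_mul _

/-- A change of scale preserves integrals against a rescaled density. -/
lemma integral_rpow_neg_smul_comp_inv_smul {F : Type*} [NormedAddCommGroup F] [NormedSpace ℝ F]
    {γ : ℝ} (hγ : 0 < γ) (f : EuclideanSpace ℝ (Fin d) → F) :
    ∫ x, γ ^ (-(d : ℝ)) • f (γ⁻¹ • x) = ∫ x, f x := by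
  rw [integral_smul, Measure.integral_comp_smul, smul_smul, finrank_euclideanSpace_fin,
    abs_of_pos (by positivity), inv_pow, inv_inv, Real.rpow_neg hγ.le, Real.rpow_natCast,
    inv_mul_cancel₀ (by positivity), one_smul]

lemma integrable_pGam {γ : ℝ} (hγ : 0 < γ) : Integrable (pGam d γ) :=
  (integrable_pC.comp_smul (inv_ne_zero hγ.ne')).const_mul _

lemma integrable_pC_mul_log : Integrable (fun x => pC d x * log (pC d x)) := by
  set k : ℝ := Real.Gamma (((d : ℝ) + 1) / 2) * Real.pi ^ (-((d : ℝ) + 1) / 2) with hk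
  have hkpos : 0 < k := by
    have : 0 < Real.Gamma (((d : ℝ) + 1) / 2) := Real.Gamma_pos_of_pos (by positivity)
    positivity
  have h := integrable_rpow_neg_one_add_norm_sq (E := EuclideanSpace ℝ (Fin d)) (μ := volume)
    (r := (d : ℝ) + 1 / 2) (by simp)
  have hlog : Integrable (fun x : EuclideanSpace ℝ (Fin d) => pC d x * log (1 + ‖x‖ ^ 2)) := by
    refine (h.const_mul (4 * k)).mono' ?_ ?_
    · exact (measurable_pC.mul (by fun_prop)).aestronglyMeasurable
    · filter_upwards with x
      have h1 : (1 : ℝ) ≤ 1 + ‖x‖ ^ 2 := by nlinarith [sq_nonneg ‖x‖]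
      rw [Real.norm_of_nonneg (mul_nonneg (pC_pos x).le (Real.log_nonneg h1))]
      have hle := Real.log_le_rpow_div (x := 1 + ‖x‖ ^ 2) (ε := 1 / 4) (by linarith) (by norm_num)
      calc pC d x * log (1 + ‖x‖ ^ 2)
          ≤ pC d x * ((1 + ‖x‖ ^ 2) ^ (1 / 4 : ℝ) / (1 / 4)) :=
            mul_le_mul_of_nonneg_left hle (pC_pos x).le
        _ = 4 * k * ((1 + ‖x‖ ^ 2) ^ (-((d : ℝ) + 1) / 2) * (1 + ‖x‖ ^ 2) ^ (1 / 4 : ℝ)) := by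
            rw [pC, ← hk]; ring
        _ = 4 * k * (1 + ‖x‖ ^ 2) ^ (-((d : ℝ) + 1 / 2) / 2) := by
            rw [← Real.rpow_add (by linarith)]
            ring_nf
  refine ((integrable_pC.mul_const (log k)).add
    (hlog.const_mul (-((d : ℝ) + 1) / 2))).congr (.of_forall fun x => ?_)
  have h1 : (0 : ℝ) < 1 + ‖x‖ ^ 2 := by positivity
  have : log (pC d x) = log k + -((d : ℝ) + 1) / 2 * log (1 + ‖x‖ ^ 2) := by
    rw [pC, ← hk, Real.log_mul hkpos.ne' (by positivity), Real.log_rpow h1]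
  simp only [Pi.add_apply]
  rw [this]
  ring

/-- The integral over `ℝ^d` of a Gaussian against a character. -/
lemma integral_exp_neg_mul_norm_sq_mul_char {u : ℝ} (hu : 0 < u) (t : EuclideanSpace ℝ (Fin d)) :
    ∫ x : EuclideanSpace ℝ (Fin d),
      (exp (-(u * ‖x‖ ^ 2)) : ℂ) * Complex.exp (inner ℝ x t * Complex.I) =
      (((π / u) ^ ((d : ℝ) / 2) * exp (-(‖t‖ ^ 2 / (4 * u))) : ℝ) : ℂ) := by
  have h := GaussianFourier.integral_cexp_neg_mul_sq_norm_add (b := (u : ℂ)) (by simpa)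
    Complex.I t
  rw [finrank_euclideanSpace_fin] at h
  push_cast
  rw [Complex.ofReal_cpow (by positivity)]
  push_cast
  convert h using 2
  · funext x
    rw [← Complex.exp_add, real_inner_comm]
    congr 1
    ring
  · rw [Complex.I_sq]
    congr 1
    ring

lemma pC_eq_integral (x : EuclideanSpace ℝ (Fin d)) :
    pC d x = π ^ (-((d : ℝ) + 1) / 2) *
      ∫ u in Set.Ioi (0 : ℝ), u ^ (((d : ℝ) + 1) / 2 - 1) * exp (-((1 + ‖x‖ ^ 2) * u)) := by
  have h1 : (0 : ℝ) < 1 + ‖x‖ ^ 2 := by positivity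
  rw [Real.integral_rpow_mul_exp_neg_mul_Ioi (by positivity) h1, pC, one_div,
    Real.inv_rpow h1.le, ← Real.rpow_neg h1.le, neg_div]
  ring

lemma integral_pC_mul_char (t : EuclideanSpace ℝ (Fin d)) :
    ∫ x, (pC d x : ℂ) * Complex.exp (inner ℝ x t * Complex.I) = exp (-‖t‖) := by
  set s : ℝ := ((d : ℝ) + 1) / 2 with hs
  have hspos : 0 < s := by positivity
  let F : EuclideanSpace ℝ (Fin d) → ℝ → ℂ := fun x u =>
    ((u ^ (s - 1) * exp (-((1 + ‖x‖ ^ 2) * u)) : ℝ) : ℂ) *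
      Complex.exp (inner ℝ x t * Complex.I)
  have hGint : ∀ x : EuclideanSpace ℝ (Fin d), IntegrableOn
      (fun u : ℝ => u ^ (s - 1) * exp (-((1 + ‖x‖ ^ 2) * u))) (Set.Ioi 0) := by
    intro x
    have h := integrableOn_rpow_mul_exp_neg_mul_rpow (p := 1) (s := s - 1) (b := 1 + ‖x‖ ^ 2)
      (by linarith) one_pos (by positivity)
    simpa only [Real.rpow_one, neg_mul] using h
  have hFint : Integrable (Function.uncurry F)
      ((volume : Measure (EuclideanSpace ℝ (Fin d))).prod
        (volume.restrict (Set.Ioi (0 : ℝ)))) := by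
    refine (integrable_prod_iff ?_).2 ⟨.of_forall fun x => ?_, ?_⟩
    · refine Measurable.aestronglyMeasurable ?_
      simp only [F, Function.uncurry_def]
      fun_prop
    · exact (hGint x).ofReal.mul_const (Complex.exp (inner ℝ x t * Complex.I))
    · refine (integrable_pC.const_mul ((π ^ (-((d : ℝ) + 1) / 2))⁻¹)).congr
        (.of_forall fun x => ?_)
      simp only
      rw [pC_eq_integral, inv_mul_cancel_left₀ (by positivity)]
      refine setIntegral_congr_fun measurableSet_Ioi fun u hu => ?_
      have hu0 : (0 : ℝ) < u := hu
      simp only [Function.uncurry, F, norm_mul, Complex.norm_exp_ofReal_mul_I, mul_one]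
      rw [Complex.norm_real, Real.norm_of_nonneg (by positivity)]
  have hswap := integral_integral_swap hFint
  have hleft : ∀ x : EuclideanSpace ℝ (Fin d),
      (pC d x : ℂ) * Complex.exp (inner ℝ x t * Complex.I) =
        ((π ^ (-s) : ℝ) : ℂ) * ∫ u in Set.Ioi (0 : ℝ), F x u := by
    intro x
    simp only [F]
    rw [integral_mul_const, integral_complex_ofReal, pC_eq_integral, neg_div, ← hs]
    push_cast
    ring
  have hright : ∀ u ∈ Set.Ioi (0 : ℝ), ∫ x, F x u =
      ((π ^ ((d : ℝ) / 2) * (u ^ (-(1 / 2) : ℝ) * exp (-u - ‖t‖ ^ 2 / (4 * u))) : ℝ) : ℂ) := by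
    intro u hu
    have hu0 : (0 : ℝ) < u := hu
    have hfac : ∀ x, F x u = ((u ^ (s - 1) * exp (-u) : ℝ) : ℂ) *
        ((exp (-(u * ‖x‖ ^ 2)) : ℂ) * Complex.exp (inner ℝ x t * Complex.I)) := by
      intro x
      have : exp (-((1 + ‖x‖ ^ 2) * u)) = exp (-u) * exp (-(u * ‖x‖ ^ 2)) := by
        rw [← exp_add]; ring_nf
      simp only [F]
      rw [this]
      push_cast
      ring
    simp_rw [hfac]
    rw [integral_const_mul, integral_exp_neg_mul_norm_sq_mul_char hu0, ← Complex.ofReal_mul]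
    congr 1
    have hexp : exp (-u - ‖t‖ ^ 2 / (4 * u)) = exp (-u) * exp (-(‖t‖ ^ 2 / (4 * u))) := by
      rw [← exp_add]; ring_nf
    have hpow : u ^ (s - 1) = u ^ (-(1 / 2) : ℝ) * u ^ ((d : ℝ) / 2) := by
      rw [← Real.rpow_add hu0, hs]; ring_nf
    rw [hexp, hpow, Real.div_rpow pi_pos.le hu0.le]
    have : u ^ ((d : ℝ) / 2) ≠ 0 := by positivity
    field_simp
  simp_rw [hleft]
  rw [integral_const_mul, hswap, setIntegral_congr_fun measurableSet_Ioi hright,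
    integral_complex_ofReal, integral_const_mul,
    integral_rpow_mul_exp_neg_sub_div (norm_nonneg t), ← Complex.ofReal_mul]
  congr 1
  have hpi : π ^ (-s) * (π ^ ((d : ℝ) / 2) * √π) = 1 := by
    rw [Real.sqrt_eq_rpow, ← Real.rpow_add pi_pos, ← Real.rpow_add pi_pos, hs]
    ring_nf
    exact Real.rpow_zero _
  linear_combination exp (-‖t‖) * hpi

lemma integral_pC : ∫ x, pC d x = 1 := by
  have h := integral_pC_mul_char (0 : EuclideanSpace ℝ (Fin d))
  simp only [inner_zero_right, Complex.ofReal_zero, zero_mul, Complex.exp_zero, mul_one,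
    norm_zero, neg_zero, exp_zero] at h
  rw [integral_complex_ofReal] at h
  exact_mod_cast h

lemma charFun_withDensity_ofReal {f : EuclideanSpace ℝ (Fin d) → ℝ} (hf : Measurable f)
    (hpos : ∀ x, 0 ≤ f x) (t : EuclideanSpace ℝ (Fin d)) :
    charFun (volume.withDensity fun x => ENNReal.ofReal (f x)) t =
      ∫ x, (f x : ℂ) * Complex.exp (inner ℝ x t * Complex.I) := by
  rw [charFun_apply, integral_withDensity_eq_integral_toReal_smul hf.ennreal_ofReal
    (.of_forall fun _ => ENNReal.ofReal_lt_top)]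
  simp_rw [ENNReal.toReal_ofReal (hpos _), Complex.real_smul]

lemma charFun_withDensity_pC (t : EuclideanSpace ℝ (Fin d)) :
    charFun (volume.withDensity fun x => ENNReal.ofReal (pC d x)) t = exp (-‖t‖) := by
  rw [charFun_withDensity_ofReal measurable_pC fun x => (pC_pos x).le, integral_pC_mul_char]

lemma charFun_withDensity_pGam {γ : ℝ} (hγ : 0 < γ) (t : EuclideanSpace ℝ (Fin d)) :
    charFun (volume.withDensity fun x => ENNReal.ofReal (pGam d γ x)) t =
      exp (-(γ * ‖t‖)) := by
  rw [charFun_withDensity_ofReal (measurable_pGam γ) fun x => (pGam_pos hγ x).le]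
  have h := integral_rpow_neg_smul_comp_inv_smul hγ fun x : EuclideanSpace ℝ (Fin d) =>
    (pC d x : ℂ) * Complex.exp (inner ℝ x (γ • t) * Complex.I)
  rw [integral_pC_mul_char, norm_smul, Real.norm_of_nonneg hγ.le] at h
  rw [← h]
  congr 1
  funext x
  rw [real_inner_smul_left, real_inner_smul_right, inv_mul_cancel_left₀ hγ.ne', pGam,
    Complex.real_smul]
  push_cast
  ring

lemma dEnt_pGam {γ : ℝ} (hγ : 0 < γ) : dEnt (pGam d γ) = dEnt (pC d) + d * log γ := by
  have h := integral_rpow_neg_smul_comp_inv_smul hγ fun x : EuclideanSpace ℝ (Fin d) =>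
    pC d x * log (γ ^ (-(d : ℝ)) * pC d x)
  have hscale : ∫ x, pGam d γ x * log (pGam d γ x) =
      ∫ x, pC d x * log (γ ^ (-(d : ℝ)) * pC d x) := by
    rw [← h]
    congr 1
    funext x
    rw [pGam, smul_eq_mul, mul_assoc]
  have hlog : ∀ x, pC d x * log (γ ^ (-(d : ℝ)) * pC d x) =
      pC d x * (-(d : ℝ) * log γ) + pC d x * log (pC d x) := by
    intro x
    rw [Real.log_mul (Real.rpow_pos_of_pos hγ _).ne' (pC_pos x).ne', Real.log_rpow hγ]
    ring
  rw [dEnt, dEnt, hscale]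
  simp_rw [hlog]
  rw [integral_add (integrable_pC.mul_const _) integrable_pC_mul_log, integral_mul_const,
    integral_pC]
  ring

lemma dEnt_pGam_add {γ t : ℝ} (hγ : 0 < γ) (ht : 0 < t) :
    dEnt (pGam d (γ + t)) = dEnt (pGam d γ) + d * log ((γ + t) / γ) := by
  rw [dEnt_pGam hγ, dEnt_pGam (add_pos hγ ht), Real.log_div (add_pos hγ ht).ne' hγ.ne']
  ring

lemma map_add_smul_eq_withDensity_pGam {Ω : Type*} [MeasurableSpace Ω] {μ : Measure Ω}
    [IsProbabilityMeasure μ] {X C : Ω → EuclideanSpace ℝ (Fin d)} (hX : Measurable X)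
    (hC : Measurable C) (hindep : IndepFun X C μ) {γ t : ℝ} (hγ : 0 < γ) (ht : 0 < t)
    (hXlaw : Measure.map X μ = volume.withDensity fun x => ENNReal.ofReal (pGam d γ x))
    (hClaw : Measure.map C μ = volume.withDensity fun x => ENNReal.ofReal (pC d x)) :
    Measure.map (fun ω => X ω + t • C ω) μ =
      volume.withDensity fun x => ENNReal.ofReal (pGam d (γ + t) x) := by
  have hγt : 0 < γ + t := add_pos hγ ht
  have := isFiniteMeasure_withDensity_ofReal (integrable_pGam (d := d) hγt).hasFiniteIntegral
  have htC : Measurable fun ω => t • C ω := hC.const_smul t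
  refine Measure.ext_of_charFun (funext fun ξ => ?_)
  have hsum := (hindep.comp measurable_id (measurable_const_smul t)).charFun_map_add_eq_mul
    hX.aemeasurable htC.aemeasurable
  refine (congrFun hsum ξ).trans ?_
  change charFun (Measure.map X μ) ξ * charFun (Measure.map (fun ω => t • C ω) μ) ξ = _
  rw [charFun_map_smul_comp hC.aemeasurable, hXlaw, hClaw, charFun_withDensity_pGam hγ,
    charFun_withDensity_pC, charFun_withDensity_pGam hγt, norm_smul, Real.norm_of_nonneg ht.le,
    ← Complex.ofReal_mul, ← exp_add]
  ring_nf

end Cauchy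

/-- Property (4) of the `α`-Fisher information specialized to `α = 1`: if `X` is
isotropic Cauchy of scale `γ` and `C` an independent standard isotropic Cauchy vector,
then `X + tC` has density `p_{γ+t}`, `h(X+tC) = h(X) + d ln((γ+t)/γ)`, and
`J₁(X) = lim_{t→0⁺}(h(X+tC) − h(X))/t = d/γ`. -/
theorem stmt10 (d : ℕ) (hd : 1 ≤ d) (γ : ℝ) (hγ : 0 < γ)
    {Ω : Type} [MeasurableSpace Ω] (μ : Measure Ω) [IsProbabilityMeasure μ]
    (X C : Ω → EuclideanSpace ℝ (Fin d)) (hX : Measurable X) (hC : Measurable C)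
    (hindep : IndepFun X C μ)
    (hXlaw : Measure.map X μ = volume.withDensity (fun x => ENNReal.ofReal (pGam d γ x)))
    (hClaw : Measure.map C μ = volume.withDensity (fun x => ENNReal.ofReal (pC d x))) :
    (∀ t : ℝ, 0 < t → Measure.map (fun ω => X ω + t • C ω) μ =
        volume.withDensity (fun x => ENNReal.ofReal (pGam d (γ + t) x))) ∧
    (∀ t : ℝ, 0 < t →
      dEnt (pGam d (γ + t)) = dEnt (pGam d γ) + d * Real.log ((γ + t) / γ)) ∧
    Tendsto (fun t : ℝ => (dEnt (pGam d (γ + t)) - dEnt (pGam d γ)) / t)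
      (nhdsWithin 0 (Set.Ioi 0)) (nhds ((d : ℝ) / γ)) := by
  refine ⟨fun t ht => map_add_smul_eq_withDensity_pGam hX hC hindep hγ ht hXlaw hClaw,
    fun t ht => dEnt_pGam_add hγ ht, ?_⟩
  have hslope := ((Real.hasDerivAt_log hγ.ne').const_mul (d : ℝ)).tendsto_slope_zero_right
  rw [← div_eq_mul_inv] at hslope
  refine hslope.congr' ?_
  filter_upwards [self_mem_nhdsWithin] with t ht
  have ht0 : (0 : ℝ) < t := ht
  rw [dEnt_pGam_add hγ ht0, Real.log_div (add_pos hγ ht0).ne' hγ.ne', smul_eq_mul]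
  ring
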